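/- Suppose ρ₁ = ρ₂ = ρ. Then L²(μ_{M,D}) admits an infinite orthogonal set of exponential functions (i.e., there exists an infinite set Λ ⊂ ℝ² which is an orthogonal set of exponentials for μ_{M,D}) if and only if there exist positive integers s, t, r with gcd(s, t) = 1 and p ∣ t such that ρ⁻¹ = (t/s)^{1/r} (i.e., ρ^{−r} = t/s), and there exists κ ∈ ℚ such that c = κ·ρ⁻¹. -/

import Mathlib

open MeasureTheory Complex Matrix
open scoped ENNReal

noncomputable section

/-- The exponential function `e_λ(x) = e^{-2πi⟨λ,x⟩}` on `ℝ²`. -/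
def expChar (lam x : Fin 2 → ℝ) : ℂ :=
  Complex.exp ((-2 * Real.pi * Complex.I) * ((lam 0 * x 0 + lam 1 * x 1 : ℝ) : ℂ))

/-- The Fourier transform `μ̂(ξ) = ∫ e^{-2πi⟨ξ,x⟩} dμ(x)` of a measure on `ℝ²`. -/
def ftMeasure (μ : Measure (Fin 2 → ℝ)) (ξ : Fin 2 → ℝ) : ℂ :=
  ∫ x, expChar ξ x ∂μ

/-- The mask `m_D(ξ) = (1/p) Σ_{d∈D} e^{-2πi⟨ξ,d⟩}` of a digit system `D : Fin p → ℝ²`. -/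
def mask {p : ℕ} (D : Fin p → (Fin 2 → ℝ)) (ξ : Fin 2 → ℝ) : ℂ :=
  (p : ℂ)⁻¹ * ∑ i : Fin p, expChar ξ (D i)

/-- Integer digits, coerced to real vectors. -/
def digitR {p : ℕ} (D : Fin p → (Fin 2 → ℤ)) : Fin p → (Fin 2 → ℝ) :=
  fun i j => (D i j : ℝ)

/-- `μ` is the self-affine measure of the IFS `φ_d(x) = M⁻¹(x+d)`, `d ∈ D`:
a compactly supported Borel probability measure with `μ = (1/#D) Σ_d μ ∘ φ_d⁻¹`. -/
def IsSelfAffine {p : ℕ} (μ : Measure (Fin 2 → ℝ)) (M : Matrix (Fin 2) (Fin 2) ℝ)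
    (D : Fin p → (Fin 2 → ℝ)) : Prop :=
  IsProbabilityMeasure μ ∧ (∃ K : Set (Fin 2 → ℝ), IsCompact K ∧ μ Kᶜ = 0) ∧
  μ = (p : ℝ≥0∞)⁻¹ • ∑ i : Fin p, μ.map (fun x => M⁻¹.mulVec (x + D i))

/-- `Λ` is an orthogonal set of exponentials for `μ`. -/
def IsOrthoSet (μ : Measure (Fin 2 → ℝ)) (Λ : Set (Fin 2 → ℝ)) : Prop :=
  ∀ l ∈ Λ, ∀ l' ∈ Λ, l ≠ l' → ftMeasure μ (l - l') = 0

/-- `μ` is a spectral measure: some countable set of exponentials forms an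
orthonormal (Hilbert) basis of `L²(μ)`. -/
def IsSpectral (μ : Measure (Fin 2 → ℝ)) : Prop :=
  ∃ Λ : Set (Fin 2 → ℝ), Λ.Countable ∧
    ∃ b : HilbertBasis Λ ℂ (Lp ℂ 2 μ),
      ∀ lam : Λ, ⇑(b lam) =ᵐ[μ] expChar (lam : Fin 2 → ℝ)

/-- The standing assumption on the digit set: `a = (a₁,a₂)` has entries in `[1,p-1]`
and `Z(m_D) = ⋃_{j=1}^{p-1} (j·a/p + ℤ²)`. -/
def ZeroSetCond (p : ℕ) (D : Fin p → (Fin 2 → ℤ)) (a : Fin 2 → ℤ) : Prop :=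
  (∀ i, 1 ≤ a i ∧ a i ≤ (p : ℤ) - 1) ∧
  ∀ ξ : Fin 2 → ℝ, mask (digitR D) ξ = 0 ↔
    ∃ j : ℕ, 1 ≤ j ∧ j ≤ p - 1 ∧ ∃ k : Fin 2 → ℤ,
      ∀ i, ξ i = (j : ℝ) * (a i : ℝ) / p + (k i : ℝ)

/-- The upper-triangular expanding matrix `M = [[ρ₁⁻¹, c],[0, ρ₂⁻¹]]`. -/
def Mupper (ρ₁ ρ₂ c : ℝ) : Matrix (Fin 2) (Fin 2) ℝ := !![ρ₁⁻¹, c; 0, ρ₂⁻¹]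

/-- The set `E_a = {h/l : gcd(h,l)=1, l·a₂ − h·a₁ ∈ ℤ∖pℤ} ∪ {0}`. -/
def Ea (p : ℕ) (a : Fin 2 → ℤ) : Set ℝ :=
  {x | ∃ h l : ℤ, Int.gcd h l = 1 ∧ ¬ ((p : ℤ) ∣ (l * a 1 - h * a 0)) ∧
    x = (h : ℝ) / (l : ℝ)} ∪ {0}


lemma sa_exists_val (p : ℕ) (hp : p.Prime) :
    ∃ V : ValuationSubring ℝ, V.valuation (p : ℝ) < 1 := by
  have hne : (Ideal.span {(p : (⊥ : Subring ℝ))}) ≠ ⊤ := by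
    intro h
    rw [Ideal.span_singleton_eq_top] at h
    obtain ⟨y, hy⟩ := h.exists_right_inv
    obtain ⟨n, hn⟩ := Subring.mem_bot.1 y.2
    have h1 : (p : ℝ) * (n : ℝ) = 1 := by
      have := congrArg (Subtype.val) hy
      simpa [hn] using this
    have h2 : (p : ℤ) * n = 1 := by exact_mod_cast h1
    have h3 : (p : ℤ) ∣ 1 := ⟨n, h2.symm⟩
    have h4 := hp.one_lt
    have := Int.le_of_dvd one_pos h3
    omega
  obtain ⟨V, hV, hV2⟩ := Ideal.image_subset_nonunits_valuationSubring _ hne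
  refine ⟨V, ?_⟩
  have : (p : ℝ) ∈ V.nonunits := hV2 ⟨(p : (⊥ : Subring ℝ)), Ideal.mem_span_singleton_self _, by simp⟩
  exact V.mem_nonunits_iff.1 this

lemma sa_val_int (V : ValuationSubring ℝ) (n : ℤ) : V.valuation (n : ℝ) ≤ 1 :=
  (V.valuation_le_one_iff _).2 (intCast_mem V n)

lemma sa_val_dvd {p : ℕ} (V : ValuationSubring ℝ) (hV : V.valuation (p : ℝ) < 1)
    {n : ℤ} (h : (p : ℤ) ∣ n) : V.valuation (n : ℝ) < 1 := by
  obtain ⟨k, rfl⟩ := h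
  push_cast
  rw [map_mul]
  exact mul_lt_one_of_lt_of_le hV (sa_val_int V k)

lemma sa_val_ndvd {p : ℕ} (hp : p.Prime) (V : ValuationSubring ℝ)
    (hV : V.valuation (p : ℝ) < 1)
    {n : ℤ} (h : ¬ (p : ℤ) ∣ n) : V.valuation (n : ℝ) = 1 := by
  refine le_antisymm (sa_val_int V n) ?_
  by_contra hlt
  push Not at hlt
  have hc : IsCoprime (p : ℤ) n := (Nat.prime_iff_prime_int.1 hp).coprime_iff_not_dvd.2 h
  obtain ⟨x, y, hxy⟩ := hc
  have h1 : ((x : ℝ) * p + y * n) = 1 := by exact_mod_cast hxy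
  have h2 : V.valuation ((x : ℝ) * p + y * n) < 1 := by
    refine Valuation.map_add_lt _ ?_ ?_
    · rw [map_mul, mul_comm]; exact mul_lt_one_of_lt_of_le hV (sa_val_int V x)
    · rw [map_mul, mul_comm]; exact mul_lt_one_of_lt_of_le hlt (sa_val_int V y)
  rw [h1, map_one] at h2
  exact lt_irrefl _ h2

/-- pairwise difference property -/
def SaPD (p : ℕ) (b : ℝ) (T : Set ℝ) : Prop :=
  ∀ u ∈ T, ∀ u' ∈ T, u ≠ u' → ∃ j : ℕ, 1 ≤ j ∧ ∃ x : ℤ, ¬ (p : ℤ) ∣ x ∧ u - u' = b ^ j * x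

lemma sa_unit (p : ℕ) (hp : p.Prime) (b : ℝ) (hb : b ≠ 0) (T : Set ℝ) (hT : T.Infinite)
    (hPD : SaPD p b T) : ∃ y ∈ Algebra.adjoin ℤ ({b, b⁻¹} : Set ℝ), (p : ℝ) * y = 1 := by
  set A := Algebra.adjoin ℤ ({b, b⁻¹} : Set ℝ) with hA
  have hbA : b ∈ A := Algebra.subset_adjoin (by simp)
  have hbA' : b⁻¹ ∈ A := Algebra.subset_adjoin (by simp)
  by_cases hu : IsUnit (p : A)
  · obtain ⟨y, hy⟩ := hu.exists_right_inv
    refine ⟨y, y.2, ?_⟩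
    have := congrArg (Subtype.val) hy
    simpa using this
  exfalso
  obtain ⟨m, hm, hpm⟩ := exists_max_ideal_of_mem_nonunits hu
  let : Field (A ⧸ m) := Ideal.Quotient.field m
  have hft : Algebra.FiniteType ℤ A := by
    refine (Subalgebra.fg_iff_finiteType A).1 ?_
    exact Subalgebra.fg_def.2 ⟨_, by simp, rfl⟩
  have hft2 : Algebra.FiniteType ℤ (A ⧸ m) :=
    Algebra.FiniteType.of_surjective (Ideal.Quotient.mkₐ ℤ m) (Ideal.Quotient.mkₐ_surjective ℤ m)
  have hp0 : ((p : ℕ) : A ⧸ m) = 0 := by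
    have := Ideal.Quotient.eq_zero_iff_mem.2 hpm
    simpa using this
  have : Fact p.Prime := ⟨hp⟩
  have : CharP (A ⧸ m) p := (CharP.charP_iff_prime_eq_zero hp).2 hp0
  let : Algebra (ZMod p) (A ⧸ m) := ZMod.algebra _ p
  have : IsScalarTower ℤ (ZMod p) (A ⧸ m) := IsScalarTower.of_algebraMap_eq (by intro x; simp)
  have : Algebra.FiniteType (ZMod p) (A ⧸ m) :=
    Algebra.FiniteType.of_restrictScalars_finiteType ℤ (ZMod p) _
  have : Module.Finite (ZMod p) (A ⧸ m) := finite_of_finite_type_of_isJacobsonRing _ _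
  have hF : Finite (A ⧸ m) := Module.finite_of_finite (ZMod p)
  obtain ⟨u0, hu0⟩ := hT.nonempty
  have hmem : ∀ u : T, (u : ℝ) - u0 ∈ A := by
    rintro ⟨u, hu⟩
    by_cases h : u = u0
    · simp [h]
    · obtain ⟨j, -, x, -, hx⟩ := hPD u hu u0 hu0 h
      simp only [hx]
      exact A.mul_mem (A.pow_mem hbA j) (intCast_mem A x)
  have := hT.to_subtype
  obtain ⟨u, u', hne, heq⟩ := Finite.exists_ne_map_eq_of_infinite
    (fun u : T => Ideal.Quotient.mk m ⟨(u : ℝ) - u0, hmem u⟩)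
  have h1 := Ideal.Quotient.eq.1 heq
  obtain ⟨j, -, x, hx, hxx⟩ := hPD u u.2 u' u'.2 (fun h => hne (Subtype.ext h))
  have h2 : ((x : ℤ) : A) = (⟨b⁻¹, hbA'⟩ : A) ^ j *
      ((⟨(u : ℝ) - u0, hmem u⟩ : A) - ⟨(u' : ℝ) - u0, hmem u'⟩) := by
    apply Subtype.ext
    have : ((u : ℝ) - u0) - (u' - u0) = b ^ j * x := by rw [← hxx]; ring
    push_cast
    rw [this, ← mul_assoc, ← mul_pow, inv_mul_cancel₀ hb, one_pow, one_mul]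
  have hxm : ((x : ℤ) : A) ∈ m := by rw [h2]; exact m.mul_mem_left _ h1
  obtain ⟨r, s, hrs⟩ := (Nat.prime_iff_prime_int.1 hp).coprime_iff_not_dvd.2 hx
  apply hm.ne_top
  rw [Ideal.eq_top_iff_one]
  have : (1 : A) = (r : A) * (p : A) + (s : A) * (x : A) := by
    have := congrArg (Int.cast : ℤ → A) hrs
    push_cast at this
    exact this.symm
  rw [this]
  exact m.add_mem (m.mul_mem_left _ hpm) (m.mul_mem_left _ hxm)

lemma sa_val_ne_one {p : ℕ} (hp : p.Prime) (V : ValuationSubring ℝ)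
    (hV : V.valuation (p : ℝ) < 1) (b : ℝ) (hb : b ≠ 0) (T : Set ℝ) (hT : T.Infinite)
    (hPD : SaPD p b T) : V.valuation b ≠ 1 := by
  intro h1
  obtain ⟨y, hy, hpy⟩ := sa_unit p hp b hb T hT hPD
  have hle : Algebra.adjoin ℤ ({b, b⁻¹} : Set ℝ) ≤ subalgebraOfSubring V.toSubring := by
    rw [Algebra.adjoin_le_iff]
    intro z hz
    have : z ∈ V := by
      rw [← V.valuation_le_one_iff]
      rcases hz with rfl | rfl
      · exact h1.le
      · rw [map_inv₀, h1, inv_one]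
    exact this
  have hyV : y ∈ V := hle hy
  have h2 : V.valuation ((p : ℝ) * y) < 1 := by
    rw [map_mul]
    exact mul_lt_one_of_lt_of_le hV ((V.valuation_le_one_iff _).2 hyV)
  rw [hpy, map_one] at h2
  exact lt_irrefl _ h2

lemma sa_val_level {p : ℕ} (hp : p.Prime) (V : ValuationSubring ℝ)
    (hV : V.valuation (p : ℝ) < 1) (b : ℝ) (j : ℕ) (x : ℤ) (hx : ¬ (p : ℤ) ∣ x) :
    V.valuation (b ^ j * x) = V.valuation b ^ j := by
  rw [map_mul, map_pow, sa_val_ndvd hp V hV hx, mul_one]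

lemma sa_claim {p : ℕ} (hp : p.Prime) (V : ValuationSubring ℝ)
    (hV : V.valuation (p : ℝ) < 1) (b : ℝ) (hvb : 1 < V.valuation b) (J : ℕ) :
    ∀ T : Set ℝ, T.Infinite → SaPD p b T →
      ¬ (∀ u ∈ T, ∀ u' ∈ T, u ≠ u' → V.valuation (u - u') ≤ V.valuation b ^ J) := by
  have hmono : StrictMono (fun n : ℕ => V.valuation b ^ n) := pow_right_strictMono₀ hvb
  induction J with
  | zero =>
    intro T hT hPD h
    obtain ⟨u, hu, u', hu', hne⟩ := hT.nontrivial
    obtain ⟨j, hj, x, hx, hxx⟩ := hPD u hu u' hu' hne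
    have h1 := h u hu u' hu' hne
    rw [hxx, sa_val_level hp V hV b j x hx] at h1
    have := hmono.le_iff_le.1 h1
    omega
  | succ J ih =>
    intro T hT hPD h
    obtain ⟨u0, hu0⟩ := hT.nonempty
    by_cases hinf : {u ∈ T | V.valuation (u - u0) ≤ V.valuation b ^ J}.Infinite
    · refine ih _ hinf (fun u hu u' hu' => hPD u hu.1 u' hu'.1) ?_
      intro u hu u' hu' _
      have : u - u' = (u - u0) - (u' - u0) := by ring
      rw [this]
      exact Valuation.map_sub_le _ hu.2 hu'.2
    · rw [Set.not_infinite] at hinf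
      have hT2 := (hT.sdiff hinf)
      have hlev : ∀ u : ↥(T \ {u ∈ T | V.valuation (u - u0) ≤ V.valuation b ^ J}),
          ∃ x : ℤ, (u : ℝ) - u0 = b ^ (J + 1) * x := by
        rintro ⟨u, hu, hu2⟩
        have hu3 : ¬ V.valuation (u - u0) ≤ V.valuation b ^ J := fun h => hu2 ⟨hu, h⟩
        have hne : u ≠ u0 := by
          rintro rfl
          apply hu3; simp
        obtain ⟨j, hj, x, hx, hxx⟩ := hPD u hu u0 hu0 hne
        have h1 := h u hu u0 hu0 hne
        rw [hxx, sa_val_level hp V hV b j x hx] at h1 hu3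
        have h2 := hmono.le_iff_le.1 h1
        have h3 : ¬ j ≤ J := fun h => hu3 (hmono.monotone h)
        obtain rfl : j = J + 1 := by omega
        exact ⟨x, hxx⟩
      choose x hx using hlev
      have := hT2.to_subtype
      have : NeZero p := ⟨hp.ne_zero⟩
      obtain ⟨k, hk⟩ := Finite.exists_infinite_fiber (fun u => ((x u : ℤ) : ZMod p))
      have hk' := (Set.infinite_coe_iff.1 hk).image (f := Subtype.val)
        (Subtype.val_injective.injOn)
      refine ih _ hk' ?_ ?_
      · rintro _ ⟨u, hu, rfl⟩ _ ⟨u', hu', rfl⟩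
        exact hPD u u.2.1 u' u'.2.1
      · rintro _ ⟨u, hu, rfl⟩ _ ⟨u', hu', rfl⟩ hne
        obtain ⟨j, hj, y, hy, hyy⟩ := hPD u u.2.1 u' u'.2.1 hne
        have hdv : (p : ℤ) ∣ x u - x u' := by
          rw [← ZMod.intCast_zmod_eq_zero_iff_dvd]
          have e1 : ((x u : ℤ) : ZMod p) = k := hu
          have e2 : ((x u' : ℤ) : ZMod p) = k := hu'
          push_cast
          rw [e1, e2, sub_self]
        have e : (u : ℝ) - u' = b ^ (J + 1) * ((x u - x u' : ℤ) : ℝ) := by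
          have : (u : ℝ) - u' = (u - u0) - (u' - u0) := by ring
          rw [this, hx u, hx u']; push_cast; ring
        have hlt : V.valuation ((u : ℝ) - u') < V.valuation b ^ (J + 1) := by
          rw [e, map_mul, map_pow]
          exact mul_lt_of_lt_one_right (pow_pos (zero_lt_one.trans hvb) _) (sa_val_dvd V hV hdv)
        rw [hyy, sa_val_level hp V hV b j y hy] at hlt ⊢
        have := hmono.lt_iff_lt.1 hlt
        exact hmono.monotone (by omega)

lemma sa_val_lt_one {p : ℕ} (hp : p.Prime) (V : ValuationSubring ℝ)
    (hV : V.valuation (p : ℝ) < 1) (b : ℝ) (hb : 1 < b) (T : Set ℝ) (hT : T.Infinite)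
    (hPD : SaPD p b T) : V.valuation b < 1 := by
  by_contra hcon
  have hvb : 1 < V.valuation b :=
    lt_of_le_of_ne (not_lt.1 hcon) (sa_val_ne_one hp V hV b (by positivity) T hT hPD).symm
  have hmono : StrictMono (fun n : ℕ => V.valuation b ^ n) := pow_right_strictMono₀ hvb
  obtain ⟨u0, hu0, u1, hu1, hne⟩ := hT.nontrivial
  obtain ⟨j, hj, x, hx, hxx⟩ := hPD u1 hu1 u0 hu0 hne.symm
  obtain ⟨N, hN⟩ := pow_unbounded_of_one_lt (|(x : ℝ)|) hb
  have key : ∀ u ∈ T, V.valuation (u - u0) ≤ V.valuation b ^ (j + N) := by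
    intro u hu
    by_contra hc
    rw [not_le] at hc
    have hn0 : u ≠ u0 := by
      rintro rfl
      simp at hc
    obtain ⟨j', hj', x', hx', hxx'⟩ := hPD u hu u0 hu0 hn0
    have hc2 := hc
    rw [hxx', sa_val_level hp V hV b j' x' hx'] at hc2
    have hlt := hmono.lt_iff_lt.1 hc2
    have hn1 : u ≠ u1 := by
      rintro rfl
      rw [hxx, sa_val_level hp V hV b j x hx] at hc
      have := hmono.lt_iff_lt.1 hc
      omega
    obtain ⟨j'', hj'', x'', hx'', hxx''⟩ := hPD u hu u1 hu1 hn1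
    have hv1 : V.valuation (u1 - u0) < V.valuation (u - u0) := by
      rw [hxx, hxx', sa_val_level hp V hV b j x hx, sa_val_level hp V hV b j' x' hx']
      exact hmono (by omega)
    have hv2 : V.valuation (u - u1) = V.valuation (u - u0) := by
      have : u - u1 = (u - u0) - (u1 - u0) := by ring
      rw [this]
      exact Valuation.map_sub_eq_of_lt_left _ hv1
    rw [hxx', hxx'', sa_val_level hp V hV b j'' x'' hx'', sa_val_level hp V hV b j' x' hx'] at hv2
    obtain rfl := hmono.injective hv2
    obtain ⟨d, rfl⟩ := Nat.exists_eq_add_of_lt (show j < j'' by omega)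
    have hb0 : b ^ j ≠ 0 := by positivity
    have e : (x : ℝ) = b ^ (d + 1) * ((x' - x'' : ℤ) : ℝ) := by
      apply mul_left_cancel₀ hb0
      have e2 : b ^ j * (x : ℝ) = (u - u0) - (u - u1) := by rw [← hxx]; ring
      rw [e2, hxx', hxx'']
      push_cast; ring
    have hx0 : x' - x'' ≠ 0 := by
      intro h0
      rw [h0] at e
      simp at e
      exact hx (by simp [e])
    have h1 : (1 : ℝ) ≤ |((x' - x'' : ℤ) : ℝ)| := by
      exact_mod_cast Int.one_le_abs hx0
    have h2 : |(x : ℝ)| ≥ b ^ (d + 1) := by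
      rw [e, abs_mul, abs_of_pos (by positivity)]
      exact le_mul_of_one_le_right (by positivity) h1
    have h3 : b ^ N ≤ b ^ (d + 1) := pow_le_pow_right₀ hb.le (by omega)
    linarith
  refine sa_claim hp V hV b hvb (j + N) T hT hPD ?_
  intro u hu u' hu' _
  have : u - u' = (u - u0) - (u' - u0) := by ring
  rw [this]
  exact Valuation.map_sub_le _ (key u hu) (key u' hu')

lemma sa_triple {p : ℕ} (hp : p.Prime) (V : ValuationSubring ℝ)
    (hV : V.valuation (p : ℝ) < 1) (b : ℝ) (hb : b ≠ 0) (hvb : V.valuation b < 1)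
    (T : Set ℝ) (hT : T.Infinite) (hPD : SaPD p b T) :
    ∃ u0 ∈ T, ∃ u ∈ T, ∃ u' ∈ T, u ≠ u0 ∧ u' ≠ u0 ∧
      V.valuation (u - u0) < V.valuation (u' - u0) := by
  by_contra hcon
  push Not at hcon
  have hpos : 0 < V.valuation b := by
    rw [zero_lt_iff]; exact (V.valuation.ne_zero_iff).2 hb
  have hanti : StrictAnti (fun n : ℕ => V.valuation b ^ n) := pow_right_strictAnti₀ hpos hvb
  have heq : ∀ u0 ∈ T, ∀ u ∈ T, ∀ u' ∈ T, u ≠ u0 → u' ≠ u0 →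
      V.valuation (u - u0) = V.valuation (u' - u0) := fun u0 h0 u h u' h' n n' =>
    le_antisymm (hcon u0 h0 u' h' u h n' n) (hcon u0 h0 u h u' h' n n')
  obtain ⟨u0, hu0, u1, hu1, hne⟩ := hT.nontrivial
  obtain ⟨j, hj, x1, hx1, hxx1⟩ := hPD u1 hu1 u0 hu0 hne.symm
  have hlev : ∀ u : ↥(T \ {u0}), ∃ x : ℤ, (u : ℝ) - u0 = b ^ j * x := by
    rintro ⟨u, hu, hn⟩
    obtain ⟨j', hj', x, hx, hxx⟩ := hPD u hu u0 hu0 hn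
    have := heq u0 hu0 u hu u1 hu1 hn hne.symm
    rw [hxx, hxx1, sa_val_level hp V hV b _ x hx, sa_val_level hp V hV b _ x1 hx1] at this
    obtain rfl := hanti.injective this
    exact ⟨x, hxx⟩
  choose x hx using hlev
  have := (hT.sdiff (Set.finite_singleton u0)).to_subtype
  have : NeZero p := ⟨hp.ne_zero⟩
  obtain ⟨u, u', hnn, hk⟩ := Finite.exists_ne_map_eq_of_infinite (fun u => ((x u : ℤ) : ZMod p))
  have hdv : (p : ℤ) ∣ x u - x u' := by
    rw [← ZMod.intCast_zmod_eq_zero_iff_dvd]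
    push_cast
    rw [sub_eq_zero]; exact hk
  have e : (u : ℝ) - u' = b ^ j * ((x u - x u' : ℤ) : ℝ) := by
    have : (u : ℝ) - u' = (u - u0) - (u' - u0) := by ring
    rw [this, hx u, hx u']; push_cast; ring
  have hlt : V.valuation ((u : ℝ) - u') < V.valuation b ^ j := by
    rw [e, map_mul, map_pow]
    exact mul_lt_of_lt_one_right (pow_pos hpos _) (sa_val_dvd V hV hdv)
  have h1 := heq u' u'.2.1 u u.2.1 u0 hu0 (fun h => hnn (Subtype.ext h)) (fun h => u'.2.2 h.symm)
  have h2 := heq u0 hu0 u' u'.2.1 u1 hu1 (fun h => u'.2.2 h) hne.symm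
  rw [h1, Valuation.map_sub_swap, h2, hxx1, sa_val_level hp V hV b _ x1 hx1] at hlt
  exact lt_irrefl _ hlt

/-- The arithmetic core of the forward direction. -/
lemma sa_forward {p : ℕ} (hp : p.Prime) (b κ : ℝ) (hb : 1 < b) (S : Set (Fin 2 → ℝ))
    (hS : S.Infinite)
    (h : ∀ l ∈ S, ∀ l' ∈ S, l ≠ l' → ∃ j : ℕ, 1 ≤ j ∧ ∃ x y : ℤ, ¬ (p : ℤ) ∣ x ∧
      (p : ℝ) * l 0 - p * l' 0 = b ^ j * x ∧ (p : ℝ) * l 1 - p * l' 1 = b ^ j * (y + j * κ * x)) :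
    (∃ s t r : ℕ, 0 < s ∧ 0 < t ∧ 0 < r ∧ Nat.gcd s t = 1 ∧ p ∣ t ∧
          b ^ r = (t : ℝ) / (s : ℝ)) ∧ ∃ q : ℚ, κ = q := by
  have hb0 : 0 < b := by linarith
  have hx0 : ∀ x : ℤ, ¬ (p : ℤ) ∣ x → (x : ℝ) ≠ 0 := by
    intro x hx h0
    have : x = 0 := by exact_mod_cast h0
    exact hx (by simp [this])
  set f : (Fin 2 → ℝ) → ℝ := fun l => p * l 0 with hf
  have hinj : Set.InjOn f S := by
    intro l hl l' hl' he
    by_contra hne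
    obtain ⟨j, -, x, y, hx, h1, -⟩ := h l hl l' hl' hne
    have he' : (p : ℝ) * l 0 = p * l' 0 := he
    rw [he', sub_self] at h1
    exact mul_ne_zero (pow_ne_zero _ hb0.ne') (hx0 x hx) h1.symm
  have hT := hS.image hinj
  have hPD : SaPD p b (f '' S) := by
    rintro _ ⟨l, hl, rfl⟩ _ ⟨l', hl', rfl⟩ hne
    obtain ⟨j, hj, x, y, hx, h1, -⟩ := h l hl l' hl' (fun e => hne (by rw [e]))
    exact ⟨j, hj, x, hx, h1⟩
  obtain ⟨V, hV⟩ := sa_exists_val p hp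
  have hvb := sa_val_lt_one hp V hV b hb _ hT hPD
  obtain ⟨_, ⟨l0, hl0, rfl⟩, _, ⟨l, hl, rfl⟩, _, ⟨l', hl', rfl⟩, hn, hn', hlt⟩ :=
    sa_triple hp V hV b hb0.ne' hvb _ hT hPD
  have hpos : 0 < V.valuation b := by
    rw [zero_lt_iff]; exact (V.valuation.ne_zero_iff).2 hb0.ne'
  have hanti : StrictAnti (fun n : ℕ => V.valuation b ^ n) := pow_right_strictAnti₀ hpos hvb
  obtain ⟨J, -, x, y, hx, h1, h2⟩ := h l hl l0 hl0 (fun e => hn (by rw [e]))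
  obtain ⟨j, -, x', y', hx', h1', h2'⟩ := h l' hl' l0 hl0 (fun e => hn' (by rw [e]))
  obtain ⟨j'', -, x'', y'', hx'', h1'', h2''⟩ := h l' hl' l hl
    (fun e => by rw [e] at hlt; exact lt_irrefl _ hlt)
  have hv : V.valuation (f l' - f l) = V.valuation (f l' - f l0) := by
    have : f l' - f l = (f l' - f l0) - (f l - f l0) := by ring
    rw [this]
    exact Valuation.map_sub_eq_of_lt_left _ hlt
  simp only [hf] at hlt hv
  rw [h1, h1', sa_val_level hp V hV b _ x hx, sa_val_level hp V hV b _ x' hx'] at hlt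
  rw [h1'', h1', sa_val_level hp V hV b _ x'' hx'', sa_val_level hp V hV b _ x' hx'] at hv
  obtain rfl := hanti.injective hv
  have hjJ := hanti.lt_iff_gt.1 hlt
  obtain ⟨d, rfl⟩ := Nat.exists_eq_add_of_lt hjJ
  have hbj : b ^ j'' ≠ 0 := by positivity
  have e1 : b ^ (d + 1) * x = x' - x'' := by
    apply mul_left_cancel₀ hbj
    have : b ^ j'' * (x' - x'' : ℝ) = b ^ j'' * x' - b ^ j'' * x'' := by ring
    rw [this, ← h1', ← h1'']
    have : b ^ j'' * (b ^ (d + 1) * x) = b ^ (j'' + d + 1) * x := by ring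
    rw [this, ← h1]; ring
  have e2 : b ^ (d + 1) * (y + (j'' + d + 1 : ℝ) * κ * x) =
      (y' + j'' * κ * x') - (y'' + j'' * κ * x'') := by
    apply mul_left_cancel₀ hbj
    have : b ^ j'' * ((y' + j'' * κ * x') - (y'' + j'' * κ * x'') : ℝ)
      = b ^ j'' * (y' + j'' * κ * x') - b ^ j'' * (y'' + j'' * κ * x'') := by ring
    rw [this, ← h2', ← h2'']
    have : b ^ j'' * (b ^ (d + 1) * (y + (j'' + d + 1 : ℝ) * κ * x))
      = b ^ (j'' + d + 1) * (y + ((j'' + d + 1 : ℕ) : ℝ) * κ * x) := by push_cast; ring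
    rw [this, ← h2]; ring
  have hxr := hx0 x hx
  have hB : b ^ (d + 1) = (((x' - x'' : ℤ) / (x : ℤ) : ℚ) : ℝ) := by
    push_cast
    rw [eq_div_iff hxr, e1]
  constructor
  · set q : ℚ := ((x' - x'' : ℤ) / (x : ℤ) : ℚ) with hq
    have hq0 : 0 < q := by
      have : (0 : ℝ) < (q : ℝ) := by rw [← hB]; positivity
      exact_mod_cast this
    have hnum : 0 < q.num := Rat.num_pos.2 hq0
    have hqe : (q : ℝ) = (q.num.natAbs : ℝ) / (q.den : ℝ) := by
      have h1 : (q.num.natAbs : ℝ) = (q.num : ℝ) := by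
        rw [Nat.cast_natAbs, abs_of_pos hnum]
      rw [h1]
      exact Rat.cast_def q
    refine ⟨q.den, q.num.natAbs, d + 1, q.den_pos, by omega, by omega, ?_, ?_, ?_⟩
    · rw [Nat.gcd_comm]; exact q.reduced
    · by_contra hnd
      have hnd' : ¬ (p : ℤ) ∣ (q.num.natAbs : ℤ) := by
        rwa [Int.natCast_dvd_natCast]
      have hv1 := sa_val_ndvd hp V hV hnd'
      have hden : (q.den : ℝ) ≠ 0 := by exact_mod_cast q.den_nz
      have : ((q.num.natAbs : ℤ) : ℝ) = b ^ (d + 1) * ((q.den : ℤ) : ℝ) := by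
        rw [hB, hqe, Int.cast_natCast, Int.cast_natCast]; field_simp
      rw [this, map_mul, map_pow] at hv1
      have hlt2 : V.valuation b ^ (d + 1) * V.valuation ((q.den : ℤ) : ℝ) < 1 :=
        mul_lt_one_of_lt_of_le (pow_lt_one₀ hpos.le hvb (by omega)) (sa_val_int V _)
      rw [hv1] at hlt2
      exact lt_irrefl _ hlt2
    · rw [hB, hqe]
  · refine ⟨((y' - y'' : ℤ) - ((x' - x'' : ℤ) / (x : ℤ) : ℚ) * y) / ((d + 1) * (x' - x'' : ℤ)), ?_⟩
    have hxne : (x' - x'' : ℝ) ≠ 0 := by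
      rw [← e1]; positivity
    have hd : ((d : ℝ) + 1) ≠ 0 := by positivity
    push_cast at hB ⊢
    rw [← hB, eq_div_iff (mul_ne_zero hd hxne)]
    linear_combination e2 + (-(j'' + d + 1 : ℝ) * κ) * e1

/-- iterates of the inverse transpose matrix -/
def saA (ρ κ : ℝ) (n : ℕ) (ξ : Fin 2 → ℝ) : Fin 2 → ℝ :=
  ![ρ ^ n * ξ 0, ρ ^ n * (ξ 1 - n * κ * ξ 0)]

lemma sa_expChar_add (l x y : Fin 2 → ℝ) : expChar l (x + y) = expChar l x * expChar l y := by
  unfold expChar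
  rw [← Complex.exp_add]
  congr 1
  simp only [Pi.add_apply]
  push_cast; ring

lemma sa_expChar_cont (l : Fin 2 → ℝ) : Continuous (fun x => expChar l x) := by
  unfold expChar
  fun_prop

lemma sa_expChar_cont' (x : Fin 2 → ℝ) : Continuous (fun l => expChar l x) := by
  unfold expChar
  fun_prop

lemma sa_expChar_norm (l x : Fin 2 → ℝ) : ‖expChar l x‖ = 1 := by
  unfold expChar
  have : (-2 * Real.pi * Complex.I) * ((l 0 * x 0 + l 1 * x 1 : ℝ) : ℂ)
    = ((-2 * Real.pi * (l 0 * x 0 + l 1 * x 1) : ℝ) : ℂ) * Complex.I := by push_cast; ring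
  rw [this, Complex.norm_exp_ofReal_mul_I]

lemma sa_expChar_int (ν : Measure (Fin 2 → ℝ)) [IsFiniteMeasure ν] (l : Fin 2 → ℝ) :
    Integrable (fun x => expChar l x) ν :=
  Integrable.of_bound (sa_expChar_cont l).aestronglyMeasurable 1
    (Filter.Eventually.of_forall fun x => (sa_expChar_norm l x).le)

lemma sa_inv (ρ c : ℝ) (hρ : ρ ≠ 0) : (Mupper ρ ρ c)⁻¹ = !![ρ, -c * ρ ^ 2; 0, ρ] := by
  apply Matrix.inv_eq_right_inv
  unfold Mupper
  ext i j
  fin_cases i <;> fin_cases j <;> simp [Matrix.mul_apply, Fin.sum_univ_two, hρ]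
  field_simp
  ring

lemma sa_expChar_inv (ρ c : ℝ) (hρ : ρ ≠ 0) (ξ x : Fin 2 → ℝ) :
    expChar ξ ((Mupper ρ ρ c)⁻¹.mulVec x) = expChar (saA ρ (c * ρ) 1 ξ) x := by
  rw [sa_inv ρ c hρ]
  unfold expChar saA
  congr 3
  simp [Matrix.mulVec, dotProduct, Fin.sum_univ_two]
  ring

lemma sa_ft_step {p : ℕ} (hp : p ≠ 0) (ρ c : ℝ) (hρ : ρ ≠ 0) (D : Fin p → (Fin 2 → ℝ))
    (μ : Measure (Fin 2 → ℝ)) (hμ : IsSelfAffine μ (Mupper ρ ρ c) D) (ξ : Fin 2 → ℝ) :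
    ftMeasure μ ξ = mask D (saA ρ (c * ρ) 1 ξ) * ftMeasure μ (saA ρ (c * ρ) 1 ξ) := by
  obtain ⟨hpr, -, h⟩ := hμ
  have h1 := congrArg (fun ν => ∫ x, expChar ξ x ∂ν) h
  have hcont : ∀ i, Continuous (fun x => (Mupper ρ ρ c)⁻¹.mulVec (x + D i)) := fun i =>
    Continuous.matrix_mulVec continuous_const (continuous_id.add continuous_const)
  have hfm : ∀ i, IsFiniteMeasure (μ.map (fun x => (Mupper ρ ρ c)⁻¹.mulVec (x + D i))) :=
    fun i => inferInstance
  beta_reduce at h1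
  rw [integral_smul_measure, integral_finset_sum_measure
    (fun i _ => sa_expChar_int _ ξ)] at h1
  unfold ftMeasure mask
  rw [h1]
  have h2 : ∀ i, ∫ x, expChar ξ x ∂(μ.map (fun x => (Mupper ρ ρ c)⁻¹.mulVec (x + D i)))
      = expChar (saA ρ (c * ρ) 1 ξ) (D i) * ∫ x, expChar (saA ρ (c * ρ) 1 ξ) x ∂μ := by
    intro i
    rw [integral_map (hcont i).measurable.aemeasurable
      (sa_expChar_cont ξ).aestronglyMeasurable]
    rw [← integral_const_mul]
    congr 1
    ext x
    rw [sa_expChar_inv ρ c hρ, sa_expChar_add, mul_comm]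
  simp only [h2]
  rw [← Finset.sum_mul]
  simp [Complex.real_smul, mul_assoc]

lemma sa_A_succ (ρ κ : ℝ) (n : ℕ) (ξ : Fin 2 → ℝ) :
    saA ρ κ 1 (saA ρ κ n ξ) = saA ρ κ (n + 1) ξ := by
  unfold saA
  ext i
  fin_cases i
  · simp; ring
  · simp; ring

lemma sa_A_zero (ρ κ : ℝ) (ξ : Fin 2 → ℝ) : saA ρ κ 0 ξ = ξ := by
  unfold saA
  ext i
  fin_cases i <;> simp

lemma sa_ft_cont (μ : Measure (Fin 2 → ℝ)) [IsProbabilityMeasure μ] :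
    Continuous (ftMeasure μ) := by
  unfold ftMeasure
  exact continuous_of_dominated (bound := fun _ => 1)
    (fun l => (sa_expChar_cont l).aestronglyMeasurable)
    (fun l => Filter.Eventually.of_forall fun x => (sa_expChar_norm l x).le)
    (integrable_const _) (Filter.Eventually.of_forall fun x => sa_expChar_cont' x)

lemma sa_A_tendsto (ρ κ : ℝ) (h0 : 0 < ρ) (h1 : ρ < 1) (ξ : Fin 2 → ℝ) :
    Filter.Tendsto (fun n => saA ρ κ n ξ) Filter.atTop (nhds 0) := by
  have e1 : Filter.Tendsto (fun n : ℕ => ρ ^ n) Filter.atTop (nhds 0) :=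
    tendsto_pow_atTop_nhds_zero_of_lt_one h0.le h1
  have e2 : Filter.Tendsto (fun n : ℕ => (n : ℝ) * ρ ^ n) Filter.atTop (nhds 0) :=
    tendsto_self_mul_const_pow_of_lt_one h0.le h1
  rw [tendsto_pi_nhds]
  intro i
  fin_cases i
  · have := e1.mul_const (ξ 0)
    simpa [saA] using this
  · have := (e1.mul_const (ξ 1)).sub (e2.mul_const (κ * ξ 0))
    simp only [zero_mul, sub_zero] at this
    refine (this.congr fun n => ?_)
    simp [saA]; ring

lemma sa_ft_zero {p : ℕ} (hp : p ≠ 0) (ρ c : ℝ) (h0 : 0 < ρ) (h1 : ρ < 1)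
    (D : Fin p → (Fin 2 → ℝ)) (μ : Measure (Fin 2 → ℝ))
    (hμ : IsSelfAffine μ (Mupper ρ ρ c) D) (ξ : Fin 2 → ℝ) :
    ftMeasure μ ξ = 0 ↔ ∃ j : ℕ, 1 ≤ j ∧ mask D (saA ρ (c * ρ) j ξ) = 0 := by
  have hprod : ∀ n : ℕ, ftMeasure μ ξ = (∏ j ∈ Finset.range n, mask D (saA ρ (c * ρ) (j + 1) ξ)) *
      ftMeasure μ (saA ρ (c * ρ) n ξ) := by
    intro n
    induction n with
    | zero => simp [sa_A_zero]
    | succ n ih =>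
      rw [ih, Finset.prod_range_succ, sa_ft_step hp ρ c h0.ne' D μ hμ (saA ρ (c * ρ) n ξ),
        sa_A_succ, mul_assoc]
  constructor
  · intro hz
    have hpr := hμ.1
    have ht : Filter.Tendsto (fun n => ftMeasure μ (saA ρ (c * ρ) n ξ)) Filter.atTop
        (nhds (ftMeasure μ 0)) :=
      ((sa_ft_cont μ).tendsto 0).comp (sa_A_tendsto ρ (c * ρ) h0 h1 ξ)
    have h00 : ftMeasure μ 0 = 1 := by
      simp [ftMeasure, expChar]
    rw [h00] at ht
    obtain ⟨n, hn⟩ := (ht.eventually_ne one_ne_zero).exists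
    have := hprod n
    rw [hz] at this
    rcases mul_eq_zero.1 this.symm with h | h
    · obtain ⟨j, -, hj⟩ := Finset.prod_eq_zero_iff.1 h
      exact ⟨j + 1, by omega, hj⟩
    · exact absurd h hn
  · rintro ⟨j, hj, hm⟩
    rw [hprod j]
    rw [Finset.prod_eq_zero (i := j - 1) (by simp; omega), zero_mul]
    rwa [Nat.sub_add_cancel hj]

/-- Theorem 1.1: with `ρ₁ = ρ₂ = ρ`, `L²(μ_{M,D})` admits an infinite orthogonal set of
exponentials iff `ρ⁻¹ = (t/s)^{1/r}` with `gcd(s,t)=1`, `p ∣ t`, and `c = κρ⁻¹`, `κ ∈ ℚ`. -/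
theorem stmt0 (p : ℕ) (hp : p.Prime) (ρ c : ℝ) (hρ0 : 0 < ρ) (hρ1 : ρ < 1)
    (D : Fin p → (Fin 2 → ℤ)) (hD : Function.Injective D)
    (a : Fin 2 → ℤ) (hZ : ZeroSetCond p D a)
    (μ : Measure (Fin 2 → ℝ)) (hμ : IsSelfAffine μ (Mupper ρ ρ c) (digitR D)) :
    (∃ Λ : Set (Fin 2 → ℝ), Λ.Infinite ∧ IsOrthoSet μ Λ) ↔
      ((∃ s t r : ℕ, 0 < s ∧ 0 < t ∧ 0 < r ∧ Nat.gcd s t = 1 ∧ p ∣ t ∧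
          ρ⁻¹ ^ r = (t : ℝ) / (s : ℝ)) ∧
        ∃ κ : ℚ, c = (κ : ℝ) * ρ⁻¹) := by
  have hb0 : ρ⁻¹ ≠ 0 := inv_ne_zero hρ0.ne'
  have hp0 : (p : ℝ) ≠ 0 := by exact_mod_cast hp.ne_zero
  have hft := sa_ft_zero hp.ne_zero ρ c hρ0 hρ1 (digitR D) μ hμ
  have hpi : Prime (p : ℤ) := Nat.prime_iff_prime_int.1 hp
  have hand : ¬ (p : ℤ) ∣ a 0 := by
    intro h
    have := hZ.1 0
    have := Int.le_of_dvd (by omega) h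
    omega
  constructor
  · rintro ⟨S, hS, hO⟩
    have := sa_forward hp ρ⁻¹ (c * ρ) ((one_lt_inv₀ hρ0).2 hρ1) S hS ?_
    · obtain ⟨h1, q, hq⟩ := this
      exact ⟨h1, q, by rw [← hq]; field_simp⟩
    intro l hl l' hl' hne
    obtain ⟨n, hn, hm⟩ := (hft _).1 (hO l hl l' hl' hne)
    obtain ⟨j, hj1, hj2, k, hk⟩ := (hZ.2 _).1 hm
    refine ⟨n, hn, j * a 0 + p * k 0, j * a 1 + p * k 1, ?_, ?_, ?_⟩
    · intro hd
      have h1 : (p : ℤ) ∣ j * a 0 := (Int.dvd_add_left (dvd_mul_right _ _)).1 hd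
      rcases hpi.dvd_or_dvd h1 with h | h
      · have h' : p ∣ j := by exact_mod_cast h
        have := Nat.le_of_dvd (by omega) h'
        have := hp.pos
        omega
      · exact hand h
    · have e := hk 0
      simp [saA] at e
      push_cast
      have : (j * a 0 + p * k 0 : ℝ) = p * (ρ ^ n * (l 0 - l' 0)) := by
        rw [e]; field_simp
      rw [this, inv_pow]; field_simp
    · have e := hk 0
      have e' := hk 1
      simp [saA] at e e'
      push_cast
      have h1 : (j * a 0 + p * k 0 : ℝ) = p * (ρ ^ n * (l 0 - l' 0)) := by
        rw [e]; field_simp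
      have h2 : (j * a 1 + p * k 1 : ℝ) = p * (ρ ^ n * (l 1 - l' 1 - n * (c * ρ) * (l 0 - l' 0))) := by
        rw [e']; field_simp
      rw [h1, h2, inv_pow]; field_simp; ring
  · rintro ⟨⟨s, t, r, hs, ht, hr, hst, hpt, hbr⟩, q, hq⟩
    have hcq : c * ρ = q := by rw [hq]; field_simp
    have hs0 : (s : ℝ) ≠ 0 := by positivity
    have ht0 : (t : ℝ) ≠ 0 := by positivity
    have hρr : ρ ^ r = (s : ℝ) / t := by
      rw [inv_pow] at hbr
      rw [← inv_inv (ρ ^ r), hbr, inv_div]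
    have hts : s < t := by
      have h1 : (1 : ℝ) < t / s := by
        rw [← hbr]; exact one_lt_pow₀ ((one_lt_inv₀ hρ0).2 hρ1) (by omega)
      rw [one_lt_div (by positivity)] at h1
      exact_mod_cast h1
    have hps : ¬ p ∣ s := by
      intro h
      have := Nat.dvd_gcd h hpt
      rw [hst] at this
      exact hp.one_lt.ne' (Nat.dvd_one.1 this)
    set v := q.den with hv
    have hv0 : 0 < v := q.den_pos
    have hqv : (q : ℝ) * v = q.num := by
      have := Rat.mul_den_eq_num q
      exact_mod_cast congrArg (Rat.cast : ℚ → ℝ) this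
    have hp2 := hp.two_le
    have ha0 : (0 : ℝ) < a 0 := by
      have := (hZ.1 0).1
      exact_mod_cast (by omega : 0 < a 0)
    set f : ℕ → (Fin 2 → ℝ) := fun n =>
      ![(t : ℝ) ^ (v * n) * a 0 / p, (t : ℝ) ^ (v * n) * (a 1 + r * n * q.num * a 0) / p] with hf
    have hmono : StrictMono (fun n => f n 0) := by
      intro m n hmn
      have ht1 : (1 : ℝ) < t := by exact_mod_cast (by omega : 1 < t)
      have : (t : ℝ) ^ (v * m) < (t : ℝ) ^ (v * n) :=
        pow_lt_pow_right₀ ht1 (Nat.mul_lt_mul_of_pos_left hmn hv0)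
      simp only [hf, Matrix.cons_val_zero]
      have : (0 : ℝ) < p := by positivity
      gcongr
    have hinj : Function.Injective f := fun m n h => hmono.injective (congrFun h 0)
    have key : ∀ m n : ℕ, 1 ≤ m → m < n → ∀ ε : ℤ, ε = 1 ∨ ε = -1 →
        ftMeasure μ (fun i => ε * (f m i - f n i)) = 0 := by
      intro m n hm hmn ε hε
      rw [hft]
      refine ⟨r * (v * m), Nat.mul_pos hr (Nat.mul_pos hv0 hm), ?_⟩
      rw [hZ.2, hcq]
      obtain ⟨d, rfl⟩ := Nat.exists_eq_add_of_lt hmn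
      obtain ⟨t', rfl⟩ := hpt
      have hnd : ¬ (p : ℤ) ∣ ε * (s : ℤ) ^ (v * m) := by
        intro h
        rcases hpi.dvd_or_dvd h with h | h
        · have h1 : (p : ℤ) ∣ 1 := by
            rcases hε with rfl | rfl
            · exact h
            · exact (Int.dvd_neg).1 h
          have := Int.le_of_dvd one_pos h1
          omega
        · exact hps (by exact_mod_cast hpi.dvd_of_dvd_pow h)
      have hpz : (p : ℤ) ≠ 0 := by exact_mod_cast hp.ne_zero
      have hnn := Int.emod_nonneg (ε * (s : ℤ) ^ (v * m)) hpz
      have hlt := Int.emod_lt_of_pos (ε * (s : ℤ) ^ (v * m)) (by omega : (0 : ℤ) < p)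
      have hne : (ε * (s : ℤ) ^ (v * m)) % p ≠ 0 := fun h => hnd (Int.dvd_of_emod_eq_zero h)
      have hdm := Int.emod_add_mul_ediv (ε * (s : ℤ) ^ (v * m)) p
      set R := (ε * (s : ℤ) ^ (v * m)) % p with hR
      set Q := (ε * (s : ℤ) ^ (v * m)) / p with hQ
      have hdmR : (ε : ℝ) * (s : ℝ) ^ (v * m) = R + p * Q := by exact_mod_cast hdm.symm
      have hRn : ((R.toNat : ℕ) : ℝ) = (R : ℝ) := by
        have : ((R.toNat : ℕ) : ℤ) = R := Int.toNat_of_nonneg hnn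
        exact_mod_cast congrArg (Int.cast : ℤ → ℝ) this
      have hpw : ρ ^ (r * (v * m)) * ((p * t' : ℕ) : ℝ) ^ (v * m) = (s : ℝ) ^ (v * m) := by
        rw [pow_mul, hρr, div_pow]
        field_simp
      obtain ⟨w, hw⟩ : ∃ w, v * (d + 1) = w + 1 :=
        ⟨v * (d + 1) - 1, (Nat.sub_add_cancel (Nat.mul_pos hv0 (by omega))).symm⟩
      have hpw2 : ρ ^ (r * (v * m)) * ((p * t' : ℕ) : ℝ) ^ (v * (m + d + 1))
          = (s : ℝ) ^ (v * m) * (((p * t' : ℕ) : ℝ) ^ w * (p * t')) := by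
        have : v * (m + d + 1) = v * m + (w + 1) := by rw [← hw]; ring
        rw [this, pow_add, ← mul_assoc, hpw, pow_succ]
        push_cast; ring
      have hvm : ((r * (v * m) : ℕ) : ℝ) * q = r * m * q.num := by
        rw [← hqv]; push_cast; ring
      refine ⟨R.toNat, by omega, by omega,
        ![Q * a 0 - ε * s ^ (v * m) * ((p * t') ^ w * t') * a 0,
          Q * a 1 - ε * s ^ (v * m) * ((p * t') ^ w * t') * (a 1 + r * (d + 1) * q.num * a 0)], ?_⟩
      intro i
      rw [hRn]
      fin_cases i
      · simp only [saA, hf, Fin.zero_eta, Matrix.cons_val_zero]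
        have : ρ ^ (r * (v * m)) * (ε * (((p * t' : ℕ) : ℝ) ^ (v * m) * a 0 / p
            - ((p * t' : ℕ) : ℝ) ^ (v * (m + d + 1)) * a 0 / p))
          = ε * (ρ ^ (r * (v * m)) * ((p * t' : ℕ) : ℝ) ^ (v * m)
            - ρ ^ (r * (v * m)) * ((p * t' : ℕ) : ℝ) ^ (v * (m + d + 1))) * a 0 / p := by ring
        rw [this, hpw, hpw2]
        push_cast
        field_simp
        linear_combination hdmR
      · simp only [saA, hf, Fin.mk_one, Matrix.cons_val_zero, Matrix.cons_val_one]
        rw [hvm]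
        push_cast at hpw hpw2 ⊢
        have : ρ ^ (r * (v * m)) * (ε * ((p * t' : ℝ) ^ (v * m) * (a 1 + r * m * q.num * a 0) / p
            - (p * t' : ℝ) ^ (v * (m + d + 1)) * (a 1 + r * (m + d + 1) * q.num * a 0) / p)
            - r * m * q.num * (ε * ((p * t' : ℝ) ^ (v * m) * a 0 / p
            - (p * t' : ℝ) ^ (v * (m + d + 1)) * a 0 / p)))
          = ε * ((ρ ^ (r * (v * m)) * (p * t' : ℝ) ^ (v * m)) * a 1
            - (ρ ^ (r * (v * m)) * (p * t' : ℝ) ^ (v * (m + d + 1))) *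
              (a 1 + r * (d + 1) * q.num * a 0)) / p := by ring
        rw [this, hpw, hpw2]
        field_simp
        linear_combination (a 1 : ℝ) * hdmR
    refine ⟨Set.range (fun n => f (n + 1)), Set.infinite_range_of_injective
      (fun m n h => by have := hinj h; omega), ?_⟩
    rintro _ ⟨m, rfl⟩ _ ⟨n, rfl⟩ hne
    have hmn : m ≠ n := fun h => hne (by rw [h])
    rcases lt_or_gt_of_ne hmn with h | h
    · have := key (m + 1) (n + 1) (by omega) (by omega) 1 (Or.inl rfl)
      convert this using 2
      ext i; simp
    · have := key (n + 1) (m + 1) (by omega) (by omega) (-1) (Or.inr rfl)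
      convert this using 2
      ext i; simp


end
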